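/- Let P(λ) = A_m λ^m + ⋯ + A_1 λ + A_0 be an n×n complex matrix polynomial with det A_m ≠ 0 (n, m ≥ 1), let w_0, …, w_m be nonnegative reals, w(t) = Σ w_j t^j, let ε > 0, and let Q(λ) = Σ_{j=0}^m (A_j + Δ_j) λ^j be a perturbation with ‖Δ_j‖ ≤ ε w_j for all j. If μ ∈ ℂ satisfies det Q(μ) = 0 and det P(μ) ≠ 0, then the distance from μ to the set of roots of det P satisfies min_{λ : det P(λ) = 0} |μ − λ| ≤ ( ε w(|μ|) / |det A_m| )^{1/(mn)} · ‖P(μ)‖^{(n−1)/(mn)}. -/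

import Mathlib

noncomputable section

open Matrix

/-- Euclidean norm of a complex vector. -/
def enorm2 {n : ℕ} (x : Fin n → ℂ) : ℝ := Real.sqrt (∑ i, ‖x i‖ ^ 2)

/-- Spectral norm: the operator norm induced by the Euclidean vector norm. -/
def specNorm {n : ℕ} (A : Matrix (Fin n) (Fin n) ℂ) : ℝ :=
  sSup {r : ℝ | ∃ x : Fin n → ℂ, enorm2 x = 1 ∧ r = enorm2 (A.mulVec x)}

/-- Smallest singular value: the minimum of `‖A x‖` over Euclidean-unit vectors `x`. -/
def sminSV {n : ℕ} (A : Matrix (Fin n) (Fin n) ℂ) : ℝ :=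
  sInf {r : ℝ | ∃ x : Fin n → ℂ, enorm2 x = 1 ∧ r = enorm2 (A.mulVec x)}

/-- Evaluation of the matrix polynomial `P(z) = ∑ A_j z^j`. -/
def evalP {n m : ℕ} (A : Fin (m+1) → Matrix (Fin n) (Fin n) ℂ) (z : ℂ) :
    Matrix (Fin n) (Fin n) ℂ :=
  ∑ j : Fin (m+1), z ^ (j : ℕ) • A j

/-- Derivative `P'(z) = ∑_{j≥1} j A_j z^(j-1)`. -/
def derivP {n m : ℕ} (A : Fin (m+1) → Matrix (Fin n) (Fin n) ℂ) (z : ℂ) :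
    Matrix (Fin n) (Fin n) ℂ :=
  ∑ j : Fin (m+1), (((j : ℕ) : ℂ) * z ^ ((j : ℕ) - 1)) • A j

/-- The scalar polynomial `det P(λ)`. -/
def detPoly {n m : ℕ} (A : Fin (m+1) → Matrix (Fin n) (Fin n) ℂ) : Polynomial ℂ :=
  (Matrix.of fun i k => ∑ j : Fin (m+1), Polynomial.C (A j i k) * Polynomial.X ^ (j : ℕ)).det

/-- The weight polynomial `w(t) = ∑ w_j t^j`. -/
def wval {m : ℕ} (w : Fin (m+1) → ℝ) (t : ℝ) : ℝ := ∑ j : Fin (m+1), w j * t ^ (j : ℕ)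

theorem enorm2_eq {n : ℕ} (x : Fin n → ℂ) : enorm2 x = ‖WithLp.toLp 2 x‖ := by
  rw [EuclideanSpace.norm_eq]; rfl

theorem enorm2_mulVec_eq {n : ℕ} (M : Matrix (Fin n) (Fin n) ℂ) (x : Fin n → ℂ) :
    enorm2 (M.mulVec x) =
      ‖Matrix.toEuclideanCLM (n := Fin n) (𝕜 := ℂ) M (WithLp.toLp 2 x)‖ := by
  rw [enorm2_eq, Matrix.toEuclideanCLM_toLp]

theorem enorm2_mulVec_le {n : ℕ} (M : Matrix (Fin n) (Fin n) ℂ) (x : Fin n → ℂ)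
    (hx : enorm2 x = 1) : enorm2 (M.mulVec x) ≤ specNorm M := by
  apply le_csSup
  · refine ⟨‖Matrix.toEuclideanCLM (n := Fin n) (𝕜 := ℂ) M‖, ?_⟩
    rintro r ⟨y, hy, rfl⟩
    rw [enorm2_mulVec_eq]
    have := (Matrix.toEuclideanCLM (n := Fin n) (𝕜 := ℂ) M).le_opNorm (WithLp.toLp 2 y)
    rwa [← enorm2_eq y, hy, mul_one] at this
  · exact ⟨x, hx, rfl⟩

theorem specNorm_nonneg {n : ℕ} (M : Matrix (Fin n) (Fin n) ℂ) : 0 ≤ specNorm M := by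
  apply Real.sSup_nonneg
  rintro r ⟨y, hy, rfl⟩
  exact Real.sqrt_nonneg _

theorem norm_det_le {n : ℕ} (M : Matrix (Fin n) (Fin n) ℂ) (u : Fin n → ℂ) (hu : enorm2 u = 1)
    (hn : 1 ≤ n) : ‖M.det‖ ≤ enorm2 (M.mulVec u) * specNorm M ^ (n - 1) := by
  let E := EuclideanSpace ℂ (Fin n)
  let i0 : Fin n := ⟨0, hn⟩
  let U : E := WithLp.toLp 2 u
  have hU : ‖U‖ = 1 := by rw [← enorm2_eq, hu]
  have hc : Module.finrank ℂ E = Fintype.card (Fin n) := by simp [E]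
  obtain ⟨b, hb⟩ := Orthonormal.exists_orthonormalBasis_extension_of_card_eq (𝕜 := ℂ) (E := E) hc
    (v := fun _ => U) (s := {i0}) (by
      constructor
      · intro i; simpa using hU
      · intro i j hij; exact absurd (Subsingleton.elim i j) hij)
  let T : E →ₗ[ℂ] E := Matrix.toEuclideanLin M
  have hT : LinearMap.det T = M.det := LinearMap.det_toLpLin _ _
  let f : Fin n → E := fun i => T (b i)
  let g := InnerProductSpace.gramSchmidtOrthonormalBasis hc f
  have h1 : g.toBasis.det f = LinearMap.det T * g.toBasis.det b := by
    exact Module.Basis.det_comp g.toBasis T b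
  have h2 : ‖M.det‖ = ‖g.toBasis.det f‖ := by
    rw [h1, norm_mul, OrthonormalBasis.det_to_matrix_orthonormalBasis, mul_one, hT]
  have hf : ∀ i, ‖f i‖ = enorm2 (M.mulVec (WithLp.ofLp (b i))) := fun i => by
    rw [enorm2_eq]; rfl
  rw [h2, InnerProductSpace.gramSchmidtOrthonormalBasis_det, norm_prod]
  have h3 : ∏ i, ‖inner ℂ (g i) (f i)‖ ≤ ∏ i, ‖f i‖ := by
    apply Finset.prod_le_prod
    · intros; positivity
    · intro i _
      have := norm_inner_le_norm (𝕜 := ℂ) (g i) (f i)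
      rwa [g.orthonormal.1 i, one_mul] at this
  refine h3.trans ?_
  rw [← Finset.mul_prod_erase Finset.univ _ (Finset.mem_univ i0)]
  have h0 : ‖f i0‖ = enorm2 (M.mulVec u) := by
    rw [hf, hb i0 rfl]
  rw [h0]
  apply mul_le_mul_of_nonneg_left _ (Real.sqrt_nonneg _)
  calc ∏ i ∈ Finset.univ.erase i0, ‖f i‖ ≤ ∏ i ∈ Finset.univ.erase i0, specNorm M := by
        apply Finset.prod_le_prod
        · intros; positivity
        · intro i _
          rw [hf]
          apply enorm2_mulVec_le
          rw [enorm2_eq]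
          exact b.orthonormal.1 i
    _ = _ := by simp

theorem detPoly_eval {n m : ℕ} (A : Fin (m+1) → Matrix (Fin n) (Fin n) ℂ) (z : ℂ) :
    (detPoly A).eval z = (evalP A z).det := by
  unfold detPoly evalP
  rw [← Polynomial.coe_evalRingHom, RingHom.map_det]
  congr 1
  ext i k
  simp only [RingHom.mapMatrix_apply, Matrix.map_apply, Matrix.of_apply, Matrix.sum_apply,
    Polynomial.coe_evalRingHom, Polynomial.eval_finsetSum, Polynomial.eval_mul, Polynomial.eval_C,
    Polynomial.eval_pow, Polynomial.eval_X, Matrix.smul_apply, smul_eq_mul]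
  exact Finset.sum_congr rfl fun j _ => mul_comm _ _

theorem enorm2_sum_le {n m : ℕ} (f : Fin m → Fin n → ℂ) :
    enorm2 (∑ j, f j) ≤ ∑ j, enorm2 (f j) := by
  simp only [enorm2_eq]
  rw [WithLp.toLp_sum]
  exact norm_sum_le _ _

theorem evalP_bound {n m : ℕ} (Δ : Fin (m+1) → Matrix (Fin n) (Fin n) ℂ)
    (w : Fin (m+1) → ℝ) (ε : ℝ) (hΔ : ∀ j, specNorm (Δ j) ≤ ε * w j) (μ : ℂ)
    (u : Fin n → ℂ) (hu : enorm2 u = 1) :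
    enorm2 ((evalP Δ μ).mulVec u) ≤ ε * wval w ‖μ‖ := by
  unfold evalP wval
  rw [Matrix.sum_mulVec, Finset.mul_sum]
  refine (enorm2_sum_le _).trans (Finset.sum_le_sum fun j _ => ?_)
  rw [Matrix.smul_mulVec, enorm2_eq, WithLp.toLp_smul, norm_smul, ← enorm2_eq, norm_pow]
  have := (enorm2_mulVec_le (Δ j) u hu).trans (hΔ j)
  calc _ ≤ ‖μ‖ ^ (j:ℕ) * (ε * w j) := by gcongr
    _ = _ := by ring

theorem exists_unit {n : ℕ} (M : Matrix (Fin n) (Fin n) ℂ) (h : M.det = 0) :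
    ∃ u, enorm2 u = 1 ∧ M.mulVec u = 0 := by
  obtain ⟨v, hv, h0⟩ := Matrix.exists_mulVec_eq_zero_iff.mpr h
  have hv' : WithLp.toLp 2 v ≠ 0 := by simpa using hv
  refine ⟨((‖WithLp.toLp 2 v‖⁻¹ : ℝ) : ℂ) • v, ?_, ?_⟩
  · rw [enorm2_eq, WithLp.toLp_smul, norm_smul]
    have : ‖WithLp.toLp 2 v‖ ≠ 0 := norm_ne_zero_iff.mpr hv'
    simp [this]
  · rw [Matrix.mulVec_smul, h0, smul_zero]

/-- Theorem 6.1, Elsner-like bound: if `μ` is an eigenvalue of the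
perturbed polynomial `Q` but not of `P`, then
`min_λ |μ − λ| ≤ (ε w(|μ|)/|det A_m|)^{1/(mn)} ‖P(μ)‖^{(n−1)/(mn)}`. -/
theorem stmt7 {n m : ℕ} (hn : 1 ≤ n) (hm : 1 ≤ m)
    (A Δ : Fin (m+1) → Matrix (Fin n) (Fin n) ℂ)
    (hAm : (A (Fin.last m)).det ≠ 0)
    (w : Fin (m+1) → ℝ) (hw : ∀ j, 0 ≤ w j)
    (ε : ℝ) (hε : 0 < ε)
    (hΔ : ∀ j, specNorm (Δ j) ≤ ε * w j)
    (lam : Fin (n * m) → ℂ)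
    (hfact : detPoly A =
      Polynomial.C ((A (Fin.last m)).det) *
        ∏ j : Fin (n * m), (Polynomial.X - Polynomial.C (lam j)))
    (μ : ℂ)
    (hQ : (evalP (fun j => A j + Δ j) μ).det = 0)
    (hP : (evalP A μ).det ≠ 0) :
    Finset.univ.inf' ⟨(⟨0, Nat.mul_pos hn hm⟩ : Fin (n * m)), Finset.mem_univ _⟩
        (fun i => ‖μ - lam i‖) ≤
      (ε * wval w ‖μ‖ / ‖(A (Fin.last m)).det‖) ^
          (1 / ((m : ℝ) * n)) *
        specNorm (evalP A μ) ^ (((n : ℝ) - 1) / ((m : ℝ) * n)) := by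
  obtain ⟨u, hu, hu0⟩ := exists_unit _ hQ
  have hadd : evalP (fun j => A j + Δ j) μ = evalP A μ + evalP Δ μ := by
    simp [evalP, Finset.sum_add_distrib]
  rw [hadd, Matrix.add_mulVec] at hu0
  have hPu : enorm2 ((evalP A μ).mulVec u) ≤ ε * wval w ‖μ‖ := by
    rw [eq_neg_of_add_eq_zero_left hu0, enorm2_eq, WithLp.toLp_neg, norm_neg, ← enorm2_eq]
    exact evalP_bound Δ w ε hΔ μ u hu
  have hN := specNorm_nonneg (evalP A μ)
  have hdet := norm_det_le (evalP A μ) u hu hn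
  have hW : 0 ≤ ε * wval w ‖μ‖ := le_trans (Real.sqrt_nonneg _) hPu
  have hD : 0 < ‖(A (Fin.last m)).det‖ := norm_pos_iff.mpr hAm
  set N := specNorm (evalP A μ)
  set W := ε * wval w ‖μ‖
  set D := ‖(A (Fin.last m)).det‖ with hDdef
  have hev : ‖(evalP A μ).det‖ = D * ∏ i, ‖μ - lam i‖ := by
    rw [← detPoly_eval, hfact]
    simp [Polynomial.eval_prod, norm_prod, hDdef]
  set d := Finset.univ.inf' ⟨(⟨0, Nat.mul_pos hn hm⟩ : Fin (n * m)), Finset.mem_univ _⟩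
        (fun i => ‖μ - lam i‖) with hd
  have hd0 : 0 ≤ d := Finset.le_inf' _ _ fun i _ => norm_nonneg _
  have hdp : d ^ (n * m) ≤ ∏ i, ‖μ - lam i‖ := by
    calc d ^ (n * m) = ∏ i : Fin (n * m), d := by simp
      _ ≤ _ := Finset.prod_le_prod (fun _ _ => hd0)
          fun i _ => Finset.inf'_le (fun i => ‖μ - lam i‖) (Finset.mem_univ i)
  have hmain : d ^ (n * m) ≤ (W / D) * N ^ (n - 1) := by
    refine hdp.trans ?_
    rw [div_mul_eq_mul_div, le_div_iff₀ hD, mul_comm, ← hev]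
    exact hdet.trans (by gcongr)
  have hnm : n * m ≠ 0 := (Nat.mul_pos hn hm).ne'
  have hroot : d = (d ^ (n * m)) ^ (1 / ((m : ℝ) * n)) := by
    have := Real.pow_rpow_inv_natCast hd0 hnm
    rw [one_div, mul_comm (m : ℝ)]
    push_cast at this
    exact this.symm
  rw [hroot]
  refine (Real.rpow_le_rpow (by positivity) hmain (by positivity)).trans ?_
  rw [Real.mul_rpow (by positivity) (by positivity), ← Real.rpow_natCast N, ← Real.rpow_mul hN]
  rw [Nat.cast_sub hn, Nat.cast_one, mul_one_div]
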